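/- arXiv:2401.11554 — 5 statements merged into one kernel-verified Lean document; each statement's English description precedes it below -/
import Mathlib

section
/- Let Q be a probability measure on ℝ^d with Lebesgue density q, let ρ > 0 and ε > 0, and assume ∫ ‖x‖^{ρ+ε} q(x) dx < ∞. Then ∫ q(x)^{d/(ρ+d)} dx < ∞, i.e. Q satisfies the pseudo-moment condition with parameter ρ. -/
open MeasureTheory ENNReal
noncomputable section

theorem one_add_rpow_le_two_rpow_mul {t s : ℝ} (ht : 0 ≤ t) (hs : 0 ≤ s) :
    (1 + t) ^ s ≤ 2 ^ s * (1 + t ^ s) := by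
  have hts : 0 ≤ t ^ s := Real.rpow_nonneg ht s
  rcases le_total t 1 with h | h
  · calc (1 + t) ^ s ≤ 2 ^ s := Real.rpow_le_rpow (by linarith) (by linarith) hs
      _ ≤ 2 ^ s * (1 + t ^ s) := le_mul_of_one_le_right (by positivity) (by linarith)
  · calc (1 + t) ^ s ≤ (2 * t) ^ s := Real.rpow_le_rpow (by linarith) (by linarith) hs
      _ = 2 ^ s * t ^ s := Real.mul_rpow (by norm_num) ht
      _ ≤ 2 ^ s * (1 + t ^ s) := by gcongr; linarith

/-- A weighted form of Young's inequality that trades a power of `a` for a weight `w`. -/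
theorem rpow_div_add_le {a w s δ ρ : ℝ} (ha : 0 ≤ a) (hw : 0 < w) (hδ : 0 ≤ δ) (hρ : 0 < ρ) :
    a ^ (δ / (ρ + δ)) ≤ w ^ s * a + w ^ (-(s * δ / ρ)) := by
  have hsum : 0 < ρ + δ := by linarith
  have hα : δ / (ρ + δ) ≤ 1 := by rw [div_le_one hsum]; linarith
  have hβ : ρ / (ρ + δ) ≤ 1 := by rw [div_le_one hsum]; linarith
  have hws : 0 ≤ w ^ s := by positivity
  have hwr : 0 ≤ w ^ (-(s * δ / ρ)) := by positivity
  have hyoung := Real.geom_mean_le_arith_mean2_weighted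
    (w₁ := δ / (ρ + δ)) (w₂ := ρ / (ρ + δ)) (by positivity) (by positivity)
    (mul_nonneg hws ha) hwr (by field_simp; ring)
  have heq : (w ^ s * a) ^ (δ / (ρ + δ)) * (w ^ (-(s * δ / ρ))) ^ (ρ / (ρ + δ)) =
      a ^ (δ / (ρ + δ)) := by
    rw [Real.mul_rpow hws ha, ← Real.rpow_mul hw.le, ← Real.rpow_mul hw.le, mul_right_comm,
      ← Real.rpow_add hw]
    have : s * (δ / (ρ + δ)) + -(s * δ / ρ) * (ρ / (ρ + δ)) = 0 := by field_simp; ring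
    rw [this, Real.rpow_zero, one_mul]
  rw [heq] at hyoung
  exact hyoung.trans (add_le_add (mul_le_of_le_one_left (mul_nonneg hws ha) hα)
    (mul_le_of_le_one_left hwr hβ))

/-- **Generalised moments imply the pseudo-moment condition** (Lemma `lem.pseudo.moment`).
If `X ~ Q` admits a generalised moment of order `ρ + ε` with `ε > 0`, then `Q`
satisfies the pseudo-moment condition with parameter `ρ`. -/
theorem stmt6 {d : ℕ} (hd : 1 ≤ d)
    (Q : Measure (EuclideanSpace ℝ (Fin d)))
    (q : EuclideanSpace ℝ (Fin d) → ℝ)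
    (hqmeas : Measurable q) (hq0 : ∀ z, 0 ≤ q z)
    (hQprob : IsProbabilityMeasure Q)
    (hQd : Q = volume.withDensity fun z => ENNReal.ofReal (q z))
    (ρ ε : ℝ) (hρ : 0 < ρ) (hε : 0 < ε)
    (hmom : (∫⁻ x, ENNReal.ofReal (‖x‖ ^ (ρ + ε) * q x)) < ⊤) :
    (∫⁻ x, ENNReal.ofReal (q x ^ ((d : ℝ) / (ρ + d)))) < ⊤ := by
  have hd' : (0 : ℝ) < d := by exact_mod_cast hd
  have hs : 0 ≤ ρ + ε := by linarith
  have hq : Integrable q := by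
    refine (lintegral_ofReal_ne_top_iff_integrable hqmeas.aestronglyMeasurable
      (.of_forall hq0)).1 ?_
    have h := measure_univ (μ := Q)
    rw [hQd, withDensity_apply _ MeasurableSet.univ, setLIntegral_univ] at h
    simp [h]
  have hm : Integrable fun x : EuclideanSpace ℝ (Fin d) => ‖x‖ ^ (ρ + ε) * q x :=
    (lintegral_ofReal_ne_top_iff_integrable
      ((measurable_norm.pow_const _).mul hqmeas).aestronglyMeasurable
      (.of_forall fun x => mul_nonneg (Real.rpow_nonneg (norm_nonneg x) _) (hq0 x))).1 hmom.ne
  have hw : Integrable fun x : EuclideanSpace ℝ (Fin d) =>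
      (1 + ‖x‖) ^ (-((ρ + ε) * d / ρ)) := by
    apply integrable_one_add_norm
    rw [finrank_euclideanSpace_fin, lt_div_iff₀ hρ]
    nlinarith [mul_pos hε hd']
  refine lt_of_le_of_lt (lintegral_mono fun x => ENNReal.ofReal_le_ofReal ?_)
    (((hq.add hm).const_mul (2 ^ (ρ + ε))).add hw).lintegral_lt_top
  have hpos : 0 < 1 + ‖x‖ := by positivity
  refine (rpow_div_add_le (s := ρ + ε) (hq0 x) hpos hd'.le hρ).trans ?_
  have h := mul_le_mul_of_nonneg_right
    (one_add_rpow_le_two_rpow_mul (norm_nonneg x) hs) (hq0 x)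
  simp only [Pi.add_apply]
  linarith
end
end

section
/- Let P be a probability measure on ℝ^d with Lebesgue density p satisfying the minimal mass property with parameters a_- > 0, r_- > 0. Let n, k ≥ 1 be integers, B > 0 with h := Bk/n < 1, and set c_u := B/(a_- r_-^d). Let x_1,…,x_n ∈ ℝ^d be any points and let x ∈ ℝ^d satisfy p(x) ≥ c_u k/n. If R_k(x) ≤ ζ_h(x), then p(x) R_k(x)^d ≤ Bk/(a_- n). -/
open MeasureTheory ProbabilityTheory ENNReal
noncomputable section

abbrev Euc (d : ℕ) := EuclideanSpace ℝ (Fin d)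

/-- `ζ_h(x) = inf { r > 0 : P(B(x,r)) ≥ h }`. -/
def zeta {d : ℕ} (P : Measure (Euc d)) (h : ℝ) (x : Euc d) : ℝ :=
  sInf {r : ℝ | 0 < r ∧ h ≤ (P (Metric.closedBall x r)).toReal}

/-- the `k`-th nearest neighbour distance of `x` among the points `X 0, …, X (n-1)`. -/
def kthDist {d n : ℕ} (X : Fin n → Euc d) (k : ℕ) (x : Euc d) : ℝ :=
  sInf {r : ℝ | 0 ≤ r ∧ k ≤ Nat.card {i : Fin n // dist x (X i) ≤ r}}

/-- the Hölder class `H_β(F, L)`. -/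
def HolderBall {d : ℕ} (β F L : ℝ) (f : Euc d → ℝ) : Prop :=
  (∀ x, |f x| ≤ F) ∧ ∀ x y, |f x - f y| ≤ L * ‖x - y‖ ^ β

/-- the minimal mass property with parameters `a, r₀`. -/
def MinMass {d : ℕ} (P : Measure (Euc d)) (p : Euc d → ℝ) (a r₀ : ℝ) : Prop :=
  ∀ x r, 0 < r → r ≤ r₀ → a * p x * r ^ d ≤ (P (Metric.closedBall x r)).toReal

/-- the maximal mass property with parameters `a, r₀`. -/
def MaxMass {d : ℕ} (P : Measure (Euc d)) (p : Euc d → ℝ) (a r₀ : ℝ) : Prop :=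
  ∀ x r, 0 < p x → 0 < r → r ≤ r₀ → (P (Metric.closedBall x r)).toReal ≤ a * p x * r ^ d

/-- membership in the class `𝒫(p̄, a₋, r₋, a₊, r₊)`. -/
structure MassClass {d : ℕ} (P : Measure (Euc d)) (p : Euc d → ℝ)
    (pbar am rm ap rp : ℝ) : Prop where
  prob : IsProbabilityMeasure P
  nonneg : ∀ x, 0 ≤ p x
  meas : Measurable p
  dens : P = volume.withDensity fun x => ENNReal.ofReal (p x)
  bdd : ∀ x, p x ≤ pbar
  minMass : MinMass P p am rm
  maxMass : MaxMass P p ap rp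

/-- `σ x` lists the sample indices in order of increasing distance from `x`
(a nearest-neighbour ordering, ties broken arbitrarily). -/
def SortedNN {d n : ℕ} (X : Fin n → Euc d) (σ : Euc d → Equiv.Perm (Fin n)) : Prop :=
  ∀ x, Monotone fun i => dist x (X (σ x i))

/-- the local `k`-NN regressor built from labels `Yv`, nearest-neighbour ordering `σ`
and neighbour function `k` : `f̂(x) = (1/k(x)) ∑_{i=1}^{k(x)} Y_i(x)`. -/
def locKNN {d n : ℕ} (Yv : Fin n → ℝ) (σ : Euc d → Equiv.Perm (Fin n))
    (k : Euc d → ℕ) (x : Euc d) : ℝ :=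
  (∑ i ∈ Finset.univ.filter fun i : Fin n => (i : ℕ) < k x, Yv (σ x i)) / (k x : ℝ)

/-- the two-sample `(k_P, k_Q)`-NN regressor. -/
def twoKNN {d n m : ℕ} (Yv : Fin n → ℝ) (Yv' : Fin m → ℝ)
    (σ : Euc d → Equiv.Perm (Fin n)) (σ' : Euc d → Equiv.Perm (Fin m))
    (kP kQ : Euc d → ℕ) (x : Euc d) : ℝ :=
  ((∑ i ∈ Finset.univ.filter fun i : Fin n => (i : ℕ) < kP x, Yv (σ x i)) +
    ∑ j ∈ Finset.univ.filter fun j : Fin m => (j : ℕ) < kQ x, Yv' (σ' x j)) /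
    ((kP x : ℝ) + (kQ x : ℝ))

/-- **Upper bound on the k-NN radius on the high-density region**
(Lemma `lem.bound.neighbours.density`): under the minimal mass property, if
`p(x) ≥ c_u k/n` with `c_u = B/(a₋ r₋^d)` and `R_k(x) ≤ ζ_h(x)` for `h = Bk/n`,
then `p(x) R_k(x)^d ≤ Bk/(a₋ n)`. -/
theorem stmt11 {d : ℕ} (hd : 1 ≤ d)
    (P : Measure (Euc d)) (p : Euc d → ℝ)
    (am rm : ℝ) (ham : 0 < am) (hrm : 0 < rm)
    (hp0 : ∀ x, 0 ≤ p x)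
    (hmin : MinMass P p am rm)
    (n k : ℕ) (hn : 1 ≤ n) (hk1 : 1 ≤ k) (hkn : k ≤ n)
    (B : ℝ) (hB : 0 < B) (hh : B * k / n < 1)
    (X : Fin n → Euc d) (x : Euc d)
    (hpx : B / (am * rm ^ d) * k / n ≤ p x)
    (hR : kthDist X k x ≤ zeta P (B * k / n) x) :
    p x * kthDist X k x ^ d ≤ B * k / (am * n) := by
  have hn' : (0 : ℝ) < n := by exact_mod_cast hn
  have hk' : (0 : ℝ) < k := by exact_mod_cast hk1
  have hd' : d ≠ 0 := by omega
  have hpos : 0 < p x := lt_of_lt_of_le (by positivity) hpx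
  have hrmd : B * k / (am * n * p x) ≤ rm ^ d := by
    have hrd : 0 < rm ^ d := pow_pos hrm d
    rw [div_mul_eq_mul_div, div_div, div_le_iff₀ (by positivity)] at hpx
    rw [div_le_iff₀ (by positivity)]
    linarith
  have hq : 0 < B * k / (am * n * p x) := by positivity
  obtain ⟨r, hr, hrd⟩ : ∃ r : ℝ, 0 < r ∧ r ^ d = B * k / (am * n * p x) :=
    ⟨(B * k / (am * n * p x)) ^ ((d : ℝ)⁻¹), Real.rpow_pos_of_pos hq _,
      Real.rpow_inv_natCast_pow hq.le hd'⟩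
  have hrle : r ≤ rm := le_of_pow_le_pow_left₀ hd' hrm.le (hrd ▸ hrmd)
  have hmass := hmin x r hr hrle
  have hR0 : 0 ≤ kthDist X k x := Real.sInf_nonneg fun _ h => h.1
  have hzeta : zeta P (B * k / n) x ≤ r := by
    refine csInf_le ⟨0, fun _ h => h.1.le⟩ ⟨hr, le_of_eq_of_le ?_ hmass⟩
    rw [hrd]
    field_simp
  calc p x * kthDist X k x ^ d ≤ p x * r ^ d := by gcongr; exact hR.trans hzeta
    _ = B * k / (am * n) := by
      rw [hrd]
      field_simp
end
end

section
/- Let P be a probability measure on ℝ^d with Lebesgue density p satisfying the minimal mass property with parameters a_- > 0, r_- > 0 and the maximal mass property with parameters a_+ > 0, r_+ > 0. Let n, k ≥ 1 be integers, D > 0 with h := Dk/n < 1, and set c_ℓ := D/(a_- (min(r_+, r_-))^d). Let x_1,…,x_n ∈ ℝ^d be any points and let x ∈ ℝ^d satisfy p(x) ≥ c_ℓ k/n. If R_k(x) ≥ ζ_h(x), then p(x) R_k(x)^d ≥ Dk/(a_+ n). -/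
open MeasureTheory ProbabilityTheory ENNReal
noncomputable section

/-- **Lower bound on the k-NN radius on the high-density region**
(Lemma `lem.lower.bound.neighbours.density`): under the minimal and maximal mass
properties, if `p(x) ≥ c_ℓ k/n` with `c_ℓ = D/(a₋ (min r₊ r₋)^d)` and
`R_k(x) ≥ ζ_h(x)` for `h = Dk/n`, then `p(x) R_k(x)^d ≥ Dk/(a₊ n)`. -/
theorem stmt12 {d : ℕ} (hd : 1 ≤ d)
    (P : Measure (Euc d)) (p : Euc d → ℝ)
    (am rm ap rp : ℝ) (ham : 0 < am) (hrm : 0 < rm) (hap : 0 < ap) (hrp : 0 < rp)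
    (hp0 : ∀ x, 0 ≤ p x)
    (hmin : MinMass P p am rm) (hmax : MaxMass P p ap rp)
    (n k : ℕ) (hn : 1 ≤ n) (hk1 : 1 ≤ k) (hkn : k ≤ n)
    (D : ℝ) (hD : 0 < D) (hh : D * k / n < 1)
    (X : Fin n → Euc d) (x : Euc d)
    (hpx : D / (am * (min rp rm) ^ d) * k / n ≤ p x)
    (hR : zeta P (D * k / n) x ≤ kthDist X k x) :
    D * k / (ap * n) ≤ p x * kthDist X k x ^ d := by
  have hn0 : (0 : ℝ) < n := by exact_mod_cast hn
  have hk0 : (0 : ℝ) < k := by exact_mod_cast hk1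
  have hm : 0 < min rp rm := lt_min hrp hrm
  have hmd : 0 < (min rp rm) ^ d := pow_pos hm d
  have hp : 0 < p x := lt_of_lt_of_le (by positivity) hpx
  have hdens : D * k / n ≤ am * p x * (min rp rm) ^ d := by
    calc D * k / n
        = am * (D / (am * (min rp rm) ^ d) * k / n) * (min rp rm) ^ d := by field_simp
      _ ≤ am * p x * (min rp rm) ^ d := by gcongr
  have hmass := hdens.trans (hmin x _ hm (min_le_right _ _))
  have hmS : D * k / n ≤ ap * p x * (min rp rm) ^ d :=
    hmass.trans (hmax x _ hp hm (min_le_left _ _))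
  set t : ℝ := (D * k / n / (ap * p x)) ^ ((d : ℝ)⁻¹)
  have ht0 : 0 ≤ t := by positivity
  have htd : t ^ d = D * k / n / (ap * p x) :=
    Real.rpow_inv_natCast_pow (by positivity) (by omega)
  have ht : t ≤ zeta P (D * k / n) x := by
    refine le_csInf ⟨_, hm, hmass⟩ ?_
    rintro r ⟨hr0, hr⟩
    refine le_of_pow_le_pow_left₀ (n := d) (by omega) hr0.le ?_
    rw [htd, div_le_iff₀' (by positivity)]
    rcases le_total r rp with hrr | hrr
    · exact hr.trans (hmax x r hp hr0 hrr)
    · refine hmS.trans ?_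
      gcongr
      exact (min_le_left _ _).trans hrr
  calc D * k / (ap * n) = p x * t ^ d := by rw [htd]; field_simp
    _ ≤ p x * kthDist X k x ^ d := by
      gcongr
      exact ht.trans hR
end
end

section
/- Let β ∈ (0,1], F, L > 0, f ∈ H_β(F, L), and let n ≥ 3. Let x_1,…,x_n ∈ ℝ^d, y_1,…,y_n ∈ ℝ, let k: ℝ^d → {⌈log n⌉, …, n} be any neighbour function, and let f̂ be the local k-NN regressor and f̄(x) := (1/k(x)) Σ_{i=1}^{k(x)} f(x_i(x)). Let p: ℝ^d → [0,∞) be a function, B, C, a_- > 0, and Δ ⊆ ℝ^d. Assume: (a) for every x ∈ Δ, p(x) R_{k(x)}(x)^d ≤ B k(x)/(a_- n) and p(x) > 0; (b) sup_{x ∈ ℝ^d} k(x)^{1/2} |f̂(x) − f̄(x)| ≤ √(C log n). Then for all x ∈ ℝ^d, (f̂(x) − f(x))² ≤ 2C (log n)/k(x) + 2L² (B k(x)/(a_- n p(x)))^{2β/d} · 1{x ∈ Δ} + 8F² · 1{x ∉ Δ}. -/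
open MeasureTheory ProbabilityTheory ENNReal
noncomputable section

section NearestNeighbourHelpers

variable {d n : ℕ}

lemma SortedNN.dist_le_kthDist {X : Fin n → Euc d} {σ : Euc d → Equiv.Perm (Fin n)}
    (hσ : SortedNN X σ) (x : Euc d) {k : ℕ} (hk : k ≤ n) {i : Fin n} (hi : (i : ℕ) < k) :
    dist x (X (σ x i)) ≤ kthDist X k x := by
  refine le_csInf ?_ ?_
  · refine ⟨∑ j, dist x (X j), Finset.sum_nonneg fun j _ => dist_nonneg, ?_⟩
    have hall (j : Fin n) : dist x (X j) ≤ ∑ j, dist x (X j) :=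
      Finset.single_le_sum (f := fun j => dist x (X j)) (fun j _ => dist_nonneg)
        (Finset.mem_univ j)
    rw [Nat.card_congr (Equiv.subtypeUnivEquiv hall), Nat.card_fin]
    exact hk
  · rintro r ⟨-, hr⟩
    by_contra! hlt
    have hmem (j : {j : Fin n // dist x (X j) ≤ r}) : (σ x).symm j < i := by
      by_contra! hij
      have hmono := hσ x hij
      simp only [Equiv.apply_symm_apply] at hmono
      linarith [j.2]
    have hcard := Nat.card_le_card_of_injective
      (fun j : {j : Fin n // dist x (X j) ≤ r} =>
        (⟨(σ x).symm j, hmem j⟩ : Fin i))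
      (fun a b hab => Subtype.ext ((σ x).symm.injective (Fin.ext (Fin.mk.inj hab))))
    rw [Nat.card_fin] at hcard
    omega

lemma kthDist_nonneg (X : Fin n → Euc d) (k : ℕ) (x : Euc d) : 0 ≤ kthDist X k x :=
  Real.sInf_nonneg fun _ hr => hr.1

lemma abs_locKNN_sub_le {Y : Fin n → ℝ} {σ : Euc d → Equiv.Perm (Fin n)} {k : Euc d → ℕ}
    {x : Euc d} (hk0 : 0 < k x) (hkn : k x ≤ n) {c M : ℝ}
    (h : ∀ i : Fin n, (i : ℕ) < k x → |Y (σ x i) - c| ≤ M) :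
    |locKNN Y σ k x - c| ≤ M := by
  have hk : (0 : ℝ) < k x := by exact_mod_cast hk0
  have hcard : (Finset.univ.filter fun i : Fin n => (i : ℕ) < k x).card = k x := by
    rw [Fin.card_filter_val_lt, min_eq_right hkn]
  have hsub : locKNN Y σ k x - c =
      (∑ i ∈ Finset.univ.filter fun i : Fin n => (i : ℕ) < k x, (Y (σ x i) - c)) / k x := by
    rw [Finset.sum_sub_distrib, Finset.sum_const, hcard, nsmul_eq_mul, locKNN]
    field_simp
  rw [hsub, abs_div, abs_of_pos hk, div_le_iff₀ hk]
  calc |∑ i ∈ Finset.univ.filter fun i : Fin n => (i : ℕ) < k x, (Y (σ x i) - c)|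
      ≤ ∑ i ∈ Finset.univ.filter fun i : Fin n => (i : ℕ) < k x, |Y (σ x i) - c| :=
        Finset.abs_sum_le_sum_abs _ _
    _ ≤ ∑ i ∈ Finset.univ.filter fun i : Fin n => (i : ℕ) < k x, M :=
        Finset.sum_le_sum fun i hi => h i (Finset.mem_filter.1 hi).2
    _ = M * k x := by rw [Finset.sum_const, hcard, nsmul_eq_mul, mul_comm]

lemma sq_rpow_le_rpow_of_pow_le {r A β : ℝ} (hd : 1 ≤ d) (hβ : 0 ≤ β) (hr : 0 ≤ r)
    (h : r ^ d ≤ A) : (r ^ β) ^ 2 ≤ A ^ (2 * β / d) := by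
  have hd0 : (d : ℝ) ≠ 0 := by positivity
  calc (r ^ β) ^ 2 = (r ^ d) ^ (2 * β / d) := by
        rw [← Real.rpow_natCast r d, ← Real.rpow_mul hr, ← Real.rpow_mul_natCast hr]
        congr 1
        push_cast
        field_simp
    _ ≤ A ^ (2 * β / d) := Real.rpow_le_rpow (by positivity) h (by positivity)

end NearestNeighbourHelpers

/-- **Pointwise bias–variance decomposition** (Proposition `prop.decomp.knn`):
under a radius bound on `Δ` and a uniform variance bound, the local k-NN
regressor satisfies the stated pointwise squared-error bound. -/
theorem stmt15 {d : ℕ} (hd : 1 ≤ d)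
    (β F L : ℝ) (hβ0 : 0 < β) (hβ1 : β ≤ 1) (hF : 0 < F) (hL : 0 < L)
    (f : Euc d → ℝ) (hf : HolderBall β F L f)
    (n : ℕ) (hn : 3 ≤ n)
    (X : Fin n → Euc d) (Y : Fin n → ℝ)
    (k : Euc d → ℕ) (hk : ∀ x, ⌈Real.log n⌉₊ ≤ k x ∧ k x ≤ n)
    (σ : Euc d → Equiv.Perm (Fin n)) (hσ : SortedNN X σ)
    (p : Euc d → ℝ) (hp0 : ∀ x, 0 ≤ p x)
    (B C am : ℝ) (hB : 0 < B) (hC : 0 < C) (ham : 0 < am)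
    (Δ : Set (Euc d))
    (ha : ∀ x ∈ Δ, p x * kthDist X (k x) x ^ d ≤ B * k x / (am * n) ∧ 0 < p x)
    (hb : ∀ x, Real.sqrt (k x) * |locKNN Y σ k x - locKNN (fun i => f (X i)) σ k x| ≤
      Real.sqrt (C * Real.log n)) :
    ∀ x, (locKNN Y σ k x - f x) ^ 2 ≤
      2 * C * Real.log n / k x
      + Set.indicator Δ (fun x => 2 * L ^ 2 * (B * k x / (am * n * p x)) ^ (2 * β / d)) x
      + Set.indicator Δᶜ (fun _ => 8 * F ^ 2) x := by
  intro x
  obtain ⟨hlk, hkn⟩ := hk x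
  have hlog : 0 < Real.log n := Real.log_pos (by exact_mod_cast (by omega : 1 < n))
  have hk0 : 0 < k x := (Nat.ceil_pos.2 hlog).trans_le hlk
  have hkR : (0 : ℝ) < k x := by exact_mod_cast hk0
  have hnR : (0 : ℝ) < n := by exact_mod_cast (by omega : 0 < n)
  have hvar : (locKNN Y σ k x - locKNN (fun i => f (X i)) σ k x) ^ 2 ≤
      C * Real.log n / k x := by
    rw [le_div_iff₀ hkR]
    have hsq := pow_le_pow_left₀ (by positivity) (hb x) 2
    rw [mul_pow, sq_abs, Real.sq_sqrt hkR.le, Real.sq_sqrt (by positivity)] at hsq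
    linarith
  have hsplit : (locKNN Y σ k x - f x) ^ 2 ≤
      2 * C * Real.log n / k x + 2 * (locKNN (fun i => f (X i)) σ k x - f x) ^ 2 := by
    have hadd := add_sq_le (a := locKNN Y σ k x - locKNN (fun i => f (X i)) σ k x)
      (b := locKNN (fun i => f (X i)) σ k x - f x)
    rw [sub_add_sub_cancel] at hadd
    have hassoc : 2 * C * Real.log n / k x = 2 * (C * Real.log n / k x) := by ring
    linarith
  by_cases hx : x ∈ Δ
  · obtain ⟨hrad, hpx⟩ := ha x hx
    have hR := kthDist_nonneg X (k x) x
    have hbias : |locKNN (fun i => f (X i)) σ k x - f x| ≤ L * kthDist X (k x) x ^ β := by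
      refine abs_locKNN_sub_le hk0 hkn fun i hi => (hf.2 _ _).trans ?_
      rw [← dist_eq_norm, dist_comm]
      gcongr
      exact hσ.dist_le_kthDist x hkn hi
    have hpow : kthDist X (k x) x ^ d ≤ B * k x / (am * n * p x) := by
      rw [← div_div, le_div_iff₀ hpx, mul_comm]
      exact hrad
    have hrate := sq_rpow_le_rpow_of_pow_le hd hβ0.le hR hpow
    have hsq := pow_le_pow_left₀ (abs_nonneg _) hbias 2
    rw [sq_abs, mul_pow] at hsq
    have hmul := mul_le_mul_of_nonneg_left hrate (sq_nonneg L)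
    simp only [Set.indicator_of_mem hx, Set.indicator_of_notMem (Set.notMem_compl_iff.2 hx)]
    linarith
  · have hbias : |locKNN (fun i => f (X i)) σ k x - f x| ≤ 2 * F := by
      refine abs_locKNN_sub_le hk0 hkn fun i _ => (abs_sub _ _).trans ?_
      linarith [hf.1 (X (σ x i)), hf.1 x]
    have hsq := pow_le_pow_left₀ (abs_nonneg _) hbias 2
    rw [sq_abs] at hsq
    simp only [Set.indicator_of_notMem hx, Set.indicator_of_mem (Set.mem_compl hx)]
    linarith
end
end

section
/- Let λ > 0 and let P be the exponential distribution on ℝ with density p(x) = λ e^{−λx} 1{x ≥ 0}. Then: (i) ‖p‖_∞ ≤ λ; (ii) for all x ∈ ℝ and all t ∈ (0,1], P([x−t, x+t]) ≥ e^{−λ} t p(x) (minimal mass property with a_- = e^{−λ}, r_- = 1, d = 1); (iii) for all x ≥ 0 and all t ∈ (0,1], P([x−t, x+t]) ≤ (2 sinh(λ)/λ) t p(x) (maximal mass property with a_+ = 2 sinh(λ)/λ, r_+ = 1, d = 1); (iv) for every ρ > 0, ∫ p(x)^{1/(ρ+1)} dx < ∞ (pseudo-moment condition with parameter ρ in dimension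 d = 1); (v) if p(x) = λ_P e^{−λ_P x} 1{x ≥ 0} and q(x) = λ_Q e^{−λ_Q x} 1{x ≥ 0} with λ_P, λ_Q > 0, then for every γ with 0 < γ < λ_Q/λ_P one has ∫ q(x)/p(x)^γ dx < ∞ (the pair has density ratio exponent γ). -/
open MeasureTheory ENNReal
noncomputable section

lemma sinh_mul_le_mul_sinh {a t : ℝ} (ha : 0 ≤ a) (ht : 0 ≤ t) (ht1 : t ≤ 1) :
    Real.sinh (a * t) ≤ t * Real.sinh a := by
  have hconv : ConvexOn ℝ (Set.Ici 0) Real.sinh := by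
    refine convexOn_of_deriv2_nonneg (convex_Ici 0) Real.continuous_sinh.continuousOn
      Real.differentiable_sinh.differentiableOn ?_ ?_
    · simpa using Real.differentiable_cosh.differentiableOn
    · intro x hx
      rw [interior_Ici] at hx
      simpa using (Real.sinh_pos_iff.2 hx).le
  have h := hconv.2 (x := a) ha (y := 0) Set.self_mem_Ici ht (sub_nonneg.2 ht1) (by ring)
  simpa [mul_comm] using h

lemma lintegral_ofReal_exp_decay_lt_top {f : ℝ → ℝ} {C b : ℝ} (hb : 0 < b)
    (hneg : ∀ x < 0, f x = 0) (hle : ∀ x, 0 ≤ x → f x ≤ C * Real.exp (-b * x)) :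
    (∫⁻ x, ENNReal.ofReal (f x)) < ⊤ := by
  have hint : IntegrableOn (fun x => C * Real.exp (-b * x)) (Set.Ici 0) :=
    (integrableOn_Ici_iff_integrableOn_Ioi (by simp) |>.2 (exp_neg_integrableOn_Ioi 0 hb)).const_mul C
  refine lt_of_le_of_lt ?_ hint.lintegral_lt_top
  rw [← lintegral_indicator measurableSet_Ici]
  refine lintegral_mono fun x => ?_
  by_cases hx : 0 ≤ x
  · simpa [Set.indicator, hx] using ENNReal.ofReal_le_ofReal (hle x hx)
  · simp [hneg x (not_le.1 hx)]

lemma setLIntegral_Icc_mul_exp {lam x t : ℝ} (hlam : 0 < lam) (ht : 0 < t) :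
    (∫⁻ u in Set.Icc (x - t) (x + t), ENNReal.ofReal (lam * Real.exp (-lam * u)))
      = ENNReal.ofReal (2 * Real.sinh (lam * t) * Real.exp (-lam * x)) := by
  have hcont : Continuous fun u => lam * Real.exp (-lam * u) := by fun_prop
  rw [← ofReal_integral_eq_lintegral_ofReal hcont.continuousOn.integrableOn_Icc
    (Filter.Eventually.of_forall fun u => by positivity)]
  congr 1
  rw [integral_Icc_eq_integral_Ioc, ← intervalIntegral.integral_of_le (by linarith),
    intervalIntegral.integral_eq_sub_of_hasDerivAt (f := fun u => -Real.exp (-lam * u))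
      (fun u _ => ?_) (hcont.intervalIntegrable _ _)]
  · rw [Real.sinh_eq, show -lam * (x + t) = -lam * x + -(lam * t) by ring,
      show -lam * (x - t) = -lam * x + lam * t by ring, Real.exp_add, Real.exp_add]
    ring
  · exact (((hasDerivAt_id u).const_mul (-lam)).exp.fun_neg).congr_deriv (by simp [mul_comm])

/-- **Properties of exponential source–target pairs** (Lemma `lem.example.exponential`):
the exponential distribution `ℰ(λ)` has density bounded by `λ`, satisfies the minimal
mass property with `(a₋, r₋) = (e^{−λ}, 1)`, the maximal mass property with
`(a₊, r₊) = (2 sinh(λ)/λ, 1)`, the pseudo-moment condition for every `ρ > 0`, and an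
exponential pair `(ℰ(λ_P), ℰ(λ_Q))` has density ratio exponent `γ` for every
`0 < γ < λ_Q/λ_P`. -/
theorem stmt18 (lam lamP lamQ : ℝ) (hlam : 0 < lam) (hlamP : 0 < lamP) (hlamQ : 0 < lamQ) :
    let p : ℝ → ℝ := fun x => if 0 ≤ x then lam * Real.exp (-lam * x) else 0
    let P : Measure ℝ := volume.withDensity fun x => ENNReal.ofReal (p x)
    let pP : ℝ → ℝ := fun x => if 0 ≤ x then lamP * Real.exp (-lamP * x) else 0
    let qQ : ℝ → ℝ := fun x => if 0 ≤ x then lamQ * Real.exp (-lamQ * x) else 0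
    (∀ x, p x ≤ lam) ∧
    (∀ x t : ℝ, 0 < t → t ≤ 1 →
      Real.exp (-lam) * p x * t ≤ (P (Set.Icc (x - t) (x + t))).toReal) ∧
    (∀ x t : ℝ, 0 ≤ x → 0 < t → t ≤ 1 →
      (P (Set.Icc (x - t) (x + t))).toReal ≤ (2 * Real.sinh lam / lam) * p x * t) ∧
    (∀ ρ : ℝ, 0 < ρ → (∫⁻ x, ENNReal.ofReal (p x ^ (1 / (ρ + 1)))) < ⊤) ∧
    (∀ γ : ℝ, 0 < γ → γ < lamQ / lamP →
      (∫⁻ x, ENNReal.ofReal (qQ x / pP x ^ γ)) < ⊤) := by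
  intro p P pP qQ
  have hexp_le : ∀ x, 0 ≤ x → Real.exp (-lam * x) ≤ 1 := fun x hx =>
    Real.exp_le_one_iff.2 (by nlinarith)
  have hP : ∀ x t, P (Set.Icc (x - t) (x + t))
      = ∫⁻ u in Set.Icc (x - t) (x + t), ENNReal.ofReal (p u) := fun x t =>
    withDensity_apply _ measurableSet_Icc
  have hupper : ∀ x t, 0 < t → P (Set.Icc (x - t) (x + t))
      ≤ ENNReal.ofReal (2 * Real.sinh (lam * t) * Real.exp (-lam * x)) := by
    intro x t ht
    rw [hP, ← setLIntegral_Icc_mul_exp hlam ht]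
    refine lintegral_mono fun u => ENNReal.ofReal_le_ofReal ?_
    dsimp only [p]
    split_ifs
    · exact le_rfl
    · positivity
  refine ⟨fun x => ?_, fun x t ht ht1 => ?_, fun x t hx ht ht1 => ?_, fun ρ hρ => ?_,
    fun γ hγ hγlt => ?_⟩
  · dsimp only [p]
    split_ifs with hx
    · exact mul_le_of_le_one_right hlam.le (hexp_le x hx)
    · exact hlam.le
  · by_cases hx : 0 ≤ x
    · refine (ENNReal.ofReal_le_iff_le_toReal
        (ne_top_of_le_ne_top ENNReal.ofReal_ne_top (hupper x t ht))).1 ?_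
      calc ENNReal.ofReal (Real.exp (-lam) * p x * t)
          = ∫⁻ _ in Set.Icc x (x + t), ENNReal.ofReal (Real.exp (-lam) * p x) := by
            rw [setLIntegral_const, Real.volume_Icc, add_sub_cancel_left,
              ENNReal.ofReal_mul' ht.le]
        _ ≤ ∫⁻ u in Set.Icc x (x + t), ENNReal.ofReal (p u) := by
            refine setLIntegral_mono' measurableSet_Icc fun u hu => ENNReal.ofReal_le_ofReal ?_
            simp only [p, if_pos hx, if_pos (hx.trans hu.1)]
            rw [mul_left_comm, ← Real.exp_add]
            gcongr
            nlinarith [hu.2]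
        _ ≤ P (Set.Icc (x - t) (x + t)) := by
            rw [hP]
            exact lintegral_mono_set (Set.Icc_subset_Icc_left (by linarith))
    · simp [p, hx]
  · refine ENNReal.toReal_le_of_le_ofReal ?_ ((hupper x t ht).trans
      (ENNReal.ofReal_le_ofReal ?_))
    · have := Real.sinh_pos_iff.2 hlam
      simp only [p, if_pos hx]
      positivity
    · simp only [p, if_pos hx]
      calc 2 * Real.sinh (lam * t) * Real.exp (-lam * x)
          ≤ 2 * (t * Real.sinh lam) * Real.exp (-lam * x) := by
            gcongr
            exact sinh_mul_le_mul_sinh hlam.le ht.le ht1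
        _ = 2 * Real.sinh lam / lam * (lam * Real.exp (-lam * x)) * t := by
            field_simp
  · have hs : 0 < 1 / (ρ + 1) := by positivity
    refine lintegral_ofReal_exp_decay_lt_top (C := lam ^ (1 / (ρ + 1)))
      (b := lam * (1 / (ρ + 1))) (by positivity) (fun x hx => ?_) (fun x hx => ?_)
    · simp only [p, if_neg (not_le.2 hx)]
      exact Real.zero_rpow hs.ne'
    · simp only [p, if_pos hx]
      rw [Real.mul_rpow hlam.le (Real.exp_pos _).le, ← Real.exp_mul]
      exact le_of_eq (by ring_nf)
  · rw [lt_div_iff₀ hlamP] at hγlt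
    refine lintegral_ofReal_exp_decay_lt_top (C := lamQ / lamP ^ γ)
      (b := lamQ - γ * lamP) (by linarith) (fun x hx => ?_) (fun x hx => ?_)
    · simp [qQ, hx]
    · simp only [pP, qQ, if_pos hx]
      rw [Real.mul_rpow hlamP.le (Real.exp_pos _).le, ← Real.exp_mul, mul_div_mul_comm,
        ← Real.exp_sub]
      exact le_of_eq (by ring_nf)
end
end
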